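/- Let (Δ,Θ) be a directive bi-sequence with associated prefixes (w_n) and let n ≥ 1. Suppose the prefix of length n of (Δ,Θ) is normalized, Assumption A holds for (w_n, w_{n+1}), and exactly one pseudopalindromic prefix is missed between w_n and w_{n+1}. Suppose further that w_n = w_{n−1}·p₁⁻¹·ϑ_n(w_{n−1}) and w_{n+1} = w_n·p₂⁻¹·ϑ_{n+1}(w_n), where p₁ is a suffix of w_{n−1}, p₂ is a suffix of w_n, and x·y⁻¹·z denotes x with its suffix y removed followed by z. Then |p₁| = |p₂|. -/

import Mathlib

/-- The ternary alphabet. -/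
abbrev Letter := Fin 3

/-- Finite words over the ternary alphabet. -/
abbrev Word := List Letter

/-- The four involutory antimorphisms of ternary words: the reversal `R`
and, for each letter `i`, the antimorphism `E i`. -/
inductive AM where
  | R : AM
  | E : Letter → AM
deriving DecidableEq

/-- The action of an antimorphism on a single letter: `R` fixes every letter,
and `E i` fixes `i` and exchanges the other two letters (in `Fin 3`,
this involution is `a ↦ -(i + a)`). -/
def AM.letter : AM → Letter → Letter
  | .R, _a => _a
  | .E i, a => -(i + a)

/-- The action of an antimorphism on a word: letterwise image followed by reversal. -/
def AM.apply (t : AM) (w : Word) : Word := (w.map t.letter).reverse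

/-- A word is a pseudopalindrome if it is a `ϑ`-palindrome for some
`ϑ ∈ {R, E_0, E_1, E_2}`. -/
def IsPseudopal (w : Word) : Prop := ∃ t : AM, t.apply w = w

/-- `v` is an image of `w` if `v = ϑ(w)` for some `ϑ ∈ {R, E_0, E_1, E_2}`. -/
def IsImage (w v : Word) : Prop := ∃ t : AM, v = t.apply w

/-- `v` is the `ϑ`-palindromic closure of `u`: the shortest `ϑ`-palindrome
having `u` as a prefix. -/
def IsPalClosure (t : AM) (u v : Word) : Prop :=
  u <+: v ∧ t.apply v = v ∧
    ∀ v' : Word, u <+: v' → t.apply v' = v' → v.length ≤ v'.length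

/-- `w` is the sequence of prefixes associated with the directive bi-sequence
`(Δ, Θ)`: `w 0 = ε` and `w (n+1) = (w n · δ_{n+1})^{ϑ_{n+1}}`. -/
def DirectivePrefixes (Δ : ℕ → Letter) (Θ : ℕ → AM) (w : ℕ → Word) : Prop :=
  w 0 = [] ∧ ∀ n : ℕ, IsPalClosure (Θ (n + 1)) (w n ++ [Δ (n + 1)]) (w (n + 1))

/-- A pseudopalindromic prefix `v` of `w_{n+1}` is missed between `w_n` and `w_{n+1}`
if `|w_n| < |v| < |w_{n+1}|`. -/
def MissedBetween (wn wn1 v : Word) : Prop :=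
  v <+: wn1 ∧ IsPseudopal v ∧ wn.length < v.length ∧ v.length < wn1.length

/-- An image of `u` occurs in `v` at (0-indexed) position `p`. -/
def OccursImageAt (u v : Word) (p : ℕ) : Prop :=
  p + u.length ≤ v.length ∧ IsImage u ((v.drop p).take u.length)

/-- Assumption A for the pair `(wn, wn1)`: some image of `wn` occurs in `wn1`
at a position `p` with `0 < p < |wn1| - |wn|`, overlapping both the prefix
occurrence of `wn` and the suffix occurrence of an image of `wn`. -/
def AssumptionA (wn wn1 : Word) : Prop :=
  ∃ p : ℕ, 0 < p ∧ p < wn1.length - wn.length ∧ p < wn.length ∧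
    wn1.length - wn.length < p + wn.length ∧ OccursImageAt wn wn1 p

/-- The prefix of length `n` of the directive bi-sequence is normalized:
every pseudopalindromic prefix of `w n` equals `w k` for some `k ≤ n`. -/
def NormalizedUpTo (w : ℕ → Word) (n : ℕ) : Prop :=
  ∀ v : Word, v <+: w n → IsPseudopal v → ∃ k : ℕ, k ≤ n ∧ v = w k

/-- `rep u l` is the `l`-fold concatenation `u^l`. -/
def rep (u : Word) (l : ℕ) : Word := (List.replicate l u).flatten

/-- `rmSuf x y` is `x · y⁻¹`: the word `x` with its suffix of length `|y|` removed. -/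
def rmSuf (x y : Word) : Word := x.take (x.length - y.length)

/-- `v` is a prefix of the infinite periodic word `pat^ω`. -/
def IsPrefixOfPow (pat v : Word) : Prop :=
  ∀ q : ℕ, ∀ hq : q < v.length, ∃ hp : q % pat.length < pat.length,
    v.get ⟨q, hq⟩ = pat.get ⟨q % pat.length, hp⟩

theorem AM.letter_letter (t : AM) (a : Letter) : t.letter (t.letter a) = a := by
  cases t with
  | R => rfl
  | E i => simp [AM.letter]

/-- Every involution of the alphabet is the letter action of some antimorphism. -/
theorem AM.exists_letter_eq (g : Letter → Letter) (hg : ∀ a, g (g a) = a) :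
    ∃ t : AM, ∀ a, t.letter a = g a := by
  have key : ∀ g : Letter → Letter, (∀ a, g (g a) = a) →
      (∀ a, a = g a) ∨ ∃ i : Letter, ∀ a, -(i + a) = g a := by decide
  rcases key g hg with h | ⟨i, h⟩
  · exact ⟨.R, h⟩
  · exact ⟨.E i, h⟩

/-- A permutation of three letters whose square has a fixed point is an involution. -/
theorem involutive_of_apply_apply_eq :
    ∀ g : Letter → Letter, Function.Injective g → ∀ x, g (g x) = x → ∀ a, g (g a) = a := by
  decide

/-- Two permutations of three letters that commute at one letter commute. -/
theorem commute_of_apply_eq :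
    ∀ (g h : Equiv.Perm Letter) (x : Letter), g (h x) = h (g x) → ∀ a, g (h a) = h (g a) := by
  decide

/-- The letter action of an antimorphism, as a permutation. -/
def AM.perm (t : AM) : Equiv.Perm Letter := ⟨t.letter, t.letter, t.letter_letter, t.letter_letter⟩

theorem AM.perm_apply (t : AM) (a : Letter) : t.perm a = t.letter a := rfl

theorem AM.letter_injective (t : AM) : Function.Injective t.letter := t.perm.injective

theorem AM.length_apply (t : AM) (x : Word) : (t.apply x).length = x.length := by
  simp [AM.apply]

theorem AM.getD_apply (t : AM) (x : Word) {i j : ℕ} (h : i + j + 1 = x.length) :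
    (t.apply x).getD i 0 = t.letter (x.getD j 0) := by
  have hi : i < (t.apply x).length := by rw [t.length_apply]; omega
  have hj : j < x.length := by omega
  have hij : x.length - 1 - i = j := by omega
  rw [List.getD_eq_getElem _ _ hi, List.getD_eq_getElem _ _ hj]
  simp [AM.apply, hij]

theorem AM.apply_eq_self_iff (t : AM) (x : Word) :
    t.apply x = x ↔ ∀ i j, i + j + 1 = x.length → x.getD i 0 = t.letter (x.getD j 0) := by
  constructor
  · intro h i j hij
    rw [← t.getD_apply x hij, h]
  · intro h
    refine List.ext_getElem (t.length_apply x) fun i hi hi' => ?_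
    have hij : i + (x.length - 1 - i) + 1 = x.length := by omega
    rw [← List.getD_eq_getElem _ 0 hi, ← List.getD_eq_getElem _ 0 hi', t.getD_apply x hij,
      ← h _ _ hij]

theorem List.getD_take_of_lt {α : Type*} (x : List α) (d : α) {i L : ℕ} (h : i < L) :
    (x.take L).getD i d = x.getD i d := by
  simp [List.getD_eq_getElem?_getD, h]

theorem AM.apply_take_eq_self_iff (t : AM) (x : Word) {L : ℕ} (hL : L ≤ x.length) :
    t.apply (x.take L) = x.take L ↔
      ∀ i j, i + j + 1 = L → x.getD i 0 = t.letter (x.getD j 0) := by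
  rw [t.apply_eq_self_iff, List.length_take_of_le hL]
  refine forall₃_congr fun i j hij => ?_
  rw [List.getD_take_of_lt x 0 (by omega), List.getD_take_of_lt x 0 (by omega)]

theorem isPseudopal_take_of_involution {x : Word} {L : ℕ} (hL : L ≤ x.length)
    (g : Letter → Letter) (hg : ∀ a, g (g a) = a)
    (h : ∀ i j, i + j + 1 = L → x.getD i 0 = g (x.getD j 0)) : IsPseudopal (x.take L) := by
  obtain ⟨t, ht⟩ := AM.exists_letter_eq g hg
  refine ⟨t, (t.apply_take_eq_self_iff x hL).2 fun i j hij => ?_⟩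
  rw [ht, h i j hij]

/-- A prefix that is the overlap of a prefix of length `N` with its image, under an involutory
letter map, at position `p` is a pseudopalindrome. -/
theorem isPseudopal_take_of_shift {x : Word} {N p : ℕ} (hL : N + p ≤ x.length) (hp : p ≤ N)
    (g : Letter → Letter) (hg : ∀ a, g (g a) = a)
    (h : ∀ i j, i + j + 1 = N → x.getD (p + i) 0 = g (x.getD j 0)) :
    IsPseudopal (x.take (N + p)) := by
  refine isPseudopal_take_of_involution hL g hg fun i j hij => ?_
  rcases Nat.lt_or_ge i p with hi | hi
  · have := h (j - p) i (by omega)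
    rw [show p + (j - p) = j by omega] at this
    rw [this, hg]
  · have := h (i - p) j (by omega)
    rwa [show p + (i - p) = i by omega] at this

namespace DirectivePrefixes

variable {Δ : ℕ → Letter} {Θ : ℕ → AM} {w : ℕ → Word}

theorem isPrefix_succ (hw : DirectivePrefixes Δ Θ w) (n : ℕ) : w n <+: w (n + 1) :=
  (List.prefix_append _ _).trans (hw.2 n).1

theorem length_lt_succ (hw : DirectivePrefixes Δ Θ w) (n : ℕ) :
    (w n).length < (w (n + 1)).length := by
  have := (hw.2 n).1.length_le
  simp at this
  omega

theorem strictMono_length (hw : DirectivePrefixes Δ Θ w) :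
    StrictMono fun n => (w n).length :=
  strictMono_nat_of_lt_succ hw.length_lt_succ

theorem isPseudopal (hw : DirectivePrefixes Δ Θ w) (n : ℕ) :
    IsPseudopal (w n) := by
  cases n with
  | zero => exact ⟨.R, by rw [hw.1]; rfl⟩
  | succ n => exact ⟨_, (hw.2 n).2.1⟩

end DirectivePrefixes

/-- Lemma: if exactly one pseudopalindromic prefix is missed between `w n` and
`w (n+1)`, Assumption A holds, the prefix of length `n` of the directive
bi-sequence is normalized, `w n = w_{n-1}·p₁⁻¹·ϑ_n(w_{n-1})` and
`w (n+1) = w_n·p₂⁻¹·ϑ_{n+1}(w_n)`, then `|p₁| = |p₂|`. -/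
theorem equal_deleted_suffix_lengths
    (Δ : ℕ → Letter) (Θ : ℕ → AM) (w : ℕ → Word)
    (hw : DirectivePrefixes Δ Θ w) (n : ℕ) (hn : 1 ≤ n)
    (hnorm : NormalizedUpTo w n)
    (hA : AssumptionA (w n) (w (n + 1)))
    (v : Word) (hv : MissedBetween (w n) (w (n + 1)) v)
    (huniq : ∀ v' : Word, MissedBetween (w n) (w (n + 1)) v' → v' = v)
    (p₁ p₂ u₁ u₂ : Word)
    (hsuf₁ : w (n - 1) = u₁ ++ p₁)
    (hwn : w n = u₁ ++ (Θ n).apply (w (n - 1)))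
    (hsuf₂ : w n = u₂ ++ p₂)
    (hwn1 : w (n + 1) = u₂ ++ (Θ (n + 1)).apply (w n)) :
    p₁.length = p₂.length := by
  obtain ⟨m, rfl⟩ : ∃ m, n = m + 1 := ⟨n - 1, by omega⟩
  simp only [Nat.add_sub_cancel] at hsuf₁ hwn
  set s := Θ (m + 1)
  set W := w (m + 1 + 1)
  set N := (w (m + 1)).length with hN
  set a := (w m).length with ha
  have hNM : N < W.length := hw.length_lt_succ (m + 1)
  have haN : a < N := hw.length_lt_succ m
  have hpre : w (m + 1) <+: W := hw.isPrefix_succ (m + 1)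
  have hwN : w (m + 1) = W.take N := List.prefix_iff_eq_take.1 hpre
  have hwa : w m = W.take a := List.prefix_iff_eq_take.1 ((hw.isPrefix_succ m).trans hpre)
  have hp₁ : u₁.length + p₁.length = a := by rw [ha, hsuf₁, List.length_append]
  have hlenN : N = u₁.length + a := by
    rw [hN, hwn, List.length_append, AM.length_apply]
  have hp₂ : u₂.length + p₂.length = N := by rw [hN, hsuf₂, List.length_append]
  have hlenM : W.length = u₂.length + N := by rw [hwn1, List.length_append, AM.length_apply]
  -- the prefix palindromes, expressed through the letters of `W`
  have hpalM := ((Θ (m + 1 + 1)).apply_eq_self_iff W).1 (hw.2 (m + 1)).2.1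
  set e := Θ (m + 1 + 1)
  have hpalN : ∀ i j, i + j + 1 = N → W.getD i 0 = s.letter (W.getD j 0) := by
    rw [← s.apply_take_eq_self_iff W hNM.le, ← hwN]
    exact (hw.2 m).2.1
  obtain ⟨r, hr⟩ := hw.isPseudopal m
  have hpala : ∀ i j, i + j + 1 = a → W.getD i 0 = r.letter (W.getD j 0) := by
    rwa [← r.apply_take_eq_self_iff W (haN.trans hNM).le, ← hwa]
  have hmiss : ∀ L, N < L → L < W.length → IsPseudopal (W.take L) → L = v.length := by
    intro L h₁ h₂ hL
    have hlen : (W.take L).length = L := List.length_take_of_le h₂.le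
    rw [← huniq (W.take L) ⟨List.take_prefix _ _, hL, by omega, by omega⟩, hlen]
  obtain ⟨p, hp0, hp, hpN, hpM, -, t, ht⟩ := hA
  -- the occurrence at position `p`
  have hoccp : ∀ i j, i + j + 1 = N → W.getD (p + i) 0 = t.letter (W.getD j 0) := by
    intro i j hij
    have h₁ := t.getD_apply (w (m + 1)) hij
    rw [← ht, List.getD_take_of_lt _ _ (by omega)] at h₁
    rw [hwN, List.getD_take_of_lt W 0 (by omega)] at h₁
    rw [← h₁]
    simp [List.getD_eq_getElem?_getD]
  have hvp : N + p = v.length := hmiss _ (by omega) (by omega)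
    (isPseudopal_take_of_shift (by omega) hpN.le t.letter t.letter_letter hoccp)
  -- the occurrence obtained by symmetry forces the first one to be central
  have hM : W.length = N + 2 * p := by
    obtain ⟨p', hp'⟩ : ∃ p', p' + p + N = W.length := ⟨W.length - N - p, by omega⟩
    have hocc' : ∀ i j, i + j + 1 = N →
        W.getD (p' + i) 0 = e.letter (t.letter (s.letter (W.getD j 0))) := by
      intro i j hij
      rw [hpalM (p' + i) (p + j) (by omega), hoccp j i (by omega), hpalN i j hij]
    have hinj : Function.Injective fun b => e.letter (t.letter (s.letter b)) :=
      e.letter_injective.comp (t.letter_injective.comp s.letter_injective)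
    have hfix := hocc' 0 (N - 1) (by omega)
    have hfix' := hocc' (N - 1 - p') p' (by omega)
    rw [show p' + (N - 1 - p') = N - 1 by omega] at hfix'
    rw [hfix', Nat.add_zero] at hfix
    have := hmiss (N + p') (by omega) (by omega)
      (isPseudopal_take_of_shift (by omega) (by omega) _
        (involutive_of_apply_apply_eq _ hinj _ hfix.symm) hocc')
    omega
  have hshiftp : ∀ i, i < N → W.getD (p + i) 0 = t.letter (s.letter (W.getD i 0)) := by
    intro i hi
    rw [hoccp i (N - 1 - i) (by omega), hpalN (N - 1 - i) i (by omega)]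
  -- `W.take (N - p)` is a pseudopalindrome, hence one of the earlier prefixes
  have hpa : N - p ≤ a := by
    have hL : N - p ≤ W.length := by omega
    have hpal : IsPseudopal (W.take (N - p)) := by
      refine isPseudopal_take_of_involution hL (fun b => s.letter (t.letter (s.letter b)))
        (fun b => by simp only [AM.letter_letter]) fun i j hij => ?_
      rw [hpalN i (p + j) (by omega), hshiftp j (by omega)]
    obtain ⟨k, hk, hke⟩ := hnorm (W.take (N - p))
      (by rw [hwN]; exact List.take_prefix_take_left (by omega)) hpal
    have hkl : (w k).length = N - p := by rw [← hke, List.length_take_of_le hL]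
    have hkm : k ≤ m := by
      by_contra h
      obtain rfl : k = m + 1 := by omega
      omega
    have := hw.strictMono_length.monotone hkm
    omega
  rcases hpa.eq_or_lt with h | hlt
  · omega
  exfalso
  obtain ⟨q, hq⟩ : ∃ q, q + a = N := ⟨N - a, by omega⟩
  have hshiftq : ∀ i, i < a → W.getD (q + i) 0 = s.letter (r.letter (W.getD i 0)) := by
    intro i hi
    rw [hpalN (q + i) (a - 1 - i) (by omega), hpala (a - 1 - i) i (by omega)]
  have hcomm : ∀ b, t.letter (s.letter (s.letter (r.letter b))) =
      s.letter (r.letter (t.letter (s.letter b))) := by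
    refine commute_of_apply_eq (t.perm * s.perm) (s.perm * r.perm) (W.getD 0 0) ?_
    simp only [Equiv.Perm.mul_apply, AM.perm_apply]
    rw [← hshiftq 0 (by omega), ← hshiftp 0 (by omega), ← hshiftp _ (by omega),
      ← hshiftq _ (by omega)]
    congr 1
    omega
  have hshiftq' : ∀ i, i < N → W.getD (q + i) 0 = s.letter (r.letter (W.getD i 0)) := by
    intro i hi
    rcases Nat.lt_or_ge i a with h | h
    · exact hshiftq i h
    · have h₁ := hshiftp (q + (i - p)) (by omega)
      rw [hshiftq (i - p) (by omega), hcomm, ← hshiftp (i - p) (by omega)] at h₁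
      rwa [show p + (q + (i - p)) = q + i by omega, show p + (i - p) = i by omega] at h₁
  have := hmiss (N + q) (by omega) (by omega)
    (isPseudopal_take_of_shift (by omega) (by omega)
      (fun b => s.letter (r.letter (s.letter b))) (fun b => by simp only [AM.letter_letter])
      fun i j hij => by rw [hshiftq' i (by omega), hpalN i j hij])
  omega
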